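/- Let Φ be a positive trace-preserving linear map from d×d to d'×d' complex matrices, Q a real-linear functional on Hermitian matrices, and Σ(ρ) = S(Φ(ρ)) − S(ρ) + Q(ρ). Let ρ be a density matrix, let {|i⟩} be an orthonormal basis of eigenvectors of ρ, let P = {|i⟩⟨i|} and let D_P be the set of density matrices diagonal in this basis. Suppose φ_P ∈ D_P satisfies Σ(φ_P) ≤ Σ(ω) for all ω ∈ D_P, and φ_D is a density matrix with Σ(φ_D) ≤ Σ(ω) for all density matrices ω. If supp ρ ⊆ supp φ_P and supp φ_P ⊆ supp φ_D, then the global mismatch cost decomposes as a sum of two nonnegative terms: Σ(ρ) − Σ(φ_D) = [S(ρ‖φ_P) − S(Φ(ρ)‖Φ(φ_P))] + [S(φ_P‖φ_D) − S(Φ(φ_P)‖Φ(φ_D))]. -/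

import Mathlib

open Matrix
open scoped ComplexOrder

/-- Spectral logarithm of a Hermitian matrix (eigenvalue 0 ↦ 0 via `Real.log 0 = 0`). -/
noncomputable def matLog {d : ℕ} (A : Matrix (Fin d) (Fin d) ℂ) : Matrix (Fin d) (Fin d) ℂ :=
  if hA : A.IsHermitian then
    (hA.eigenvectorUnitary : Matrix (Fin d) (Fin d) ℂ) *
      Matrix.diagonal (fun i => (Real.log (hA.eigenvalues i) : ℂ)) *
      (star (hA.eigenvectorUnitary : Matrix (Fin d) (Fin d) ℂ))
  else 0

/-- Von Neumann entropy `S(ρ) = -tr(ρ log ρ)`. -/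
noncomputable def vN {d : ℕ} (ρ : Matrix (Fin d) (Fin d) ℂ) : ℝ :=
  -(ρ * matLog ρ).trace.re

/-- Quantum relative entropy `S(ρ‖φ) = tr(ρ (log ρ - log φ))`. -/
noncomputable def qRelEnt {d : ℕ} (ρ φ : Matrix (Fin d) (Fin d) ℂ) : ℝ :=
  ((ρ * (matLog ρ - matLog φ)).trace).re

/-- A density matrix: positive semidefinite with unit trace. -/
def IsDensity {d : ℕ} (ρ : Matrix (Fin d) (Fin d) ℂ) : Prop :=
  ρ.PosSemidef ∧ ρ.trace = 1

/-- Support (= range) inclusion of matrices. -/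
def SuppLE {d : ℕ} (ρ φ : Matrix (Fin d) (Fin d) ℂ) : Prop :=
  LinearMap.range ρ.mulVecLin ≤ LinearMap.range φ.mulVecLin

/-- A positive trace-preserving linear map. -/
def IsPTP {d d' : ℕ} (Φ : Matrix (Fin d) (Fin d) ℂ →ₗ[ℂ] Matrix (Fin d') (Fin d') ℂ) : Prop :=
  (∀ X, X.PosSemidef → (Φ X).PosSemidef) ∧ (∀ X, (Φ X).trace = X.trace)

/-- The EP-type function `Σ(ρ) = S(Φ(ρ)) - S(ρ) + Q(ρ)`. -/
noncomputable def EPfun {d d' : ℕ} (Φ : Matrix (Fin d) (Fin d) ℂ →ₗ[ℂ] Matrix (Fin d') (Fin d') ℂ)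
    (Q : Matrix (Fin d) (Fin d) ℂ →ₗ[ℝ] ℝ) (ρ : Matrix (Fin d) (Fin d) ℂ) : ℝ :=
  vN (Φ ρ) - vN ρ + Q ρ


lemma aux_tr {d : ℕ} (U V : Matrix (Fin d) (Fin d) ℂ) (a b : Fin d → ℝ) :
    ((U * diagonal (fun i => (a i : ℂ)) * star U) *
      (V * diagonal (fun i => (b i : ℂ)) * star V)).trace.re
      = ∑ i, ∑ j, Complex.normSq ((star U * V) i j) * (a i * b j) := by
  have h1 : ((U * diagonal (fun i => (a i : ℂ)) * star U) *
      (V * diagonal (fun i => (b i : ℂ)) * star V)).trace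
      = (diagonal (fun i => (a i : ℂ)) * (star U * V) * diagonal (fun i => (b i : ℂ)) *
        star (star U * V)).trace := by
    rw [StarMul.star_mul, star_star]
    simp only [Matrix.mul_assoc]
    rw [Matrix.trace_mul_comm U]
    simp only [Matrix.mul_assoc]
  rw [h1]
  generalize star U * V = W
  simp only [Matrix.trace, Matrix.diag, Matrix.mul_apply (N := star W), Matrix.mul_diagonal,
    Matrix.diagonal_mul, Complex.re_sum, Matrix.star_apply]
  refine Finset.sum_congr rfl fun i _ => Finset.sum_congr rfl fun j _ => ?_
  simp [Complex.normSq_apply]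
  ring

lemma aux_spec {d : ℕ} {A : Matrix (Fin d) (Fin d) ℂ} (hA : A.IsHermitian) :
    A = (hA.eigenvectorUnitary : Matrix (Fin d) (Fin d) ℂ) *
      Matrix.diagonal (fun i => (hA.eigenvalues i : ℂ)) *
      (star (hA.eigenvectorUnitary : Matrix (Fin d) (Fin d) ℂ)) := by
  have := hA.spectral_theorem
  rw [Unitary.conjStarAlgAut_apply] at this
  exact this

lemma aux_mul {d : ℕ} {U : Matrix (Fin d) (Fin d) ℂ} (hU : star U * U = 1) (a b : Fin d → ℝ) :
    (U * diagonal (fun i => (a i : ℂ)) * star U) * (U * diagonal (fun i => (b i : ℂ)) * star U)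
      = U * diagonal (fun i => ((a i * b i : ℝ) : ℂ)) * star U := by
  have : (U * diagonal (fun i => (a i : ℂ)) * star U) * (U * diagonal (fun i => (b i : ℂ)) * star U)
    = U * (diagonal (fun i => (a i : ℂ)) * (star U * U) * diagonal (fun i => (b i : ℂ))) * star U := by
    simp only [Matrix.mul_assoc]
  rw [this, hU, Matrix.mul_one, Matrix.diagonal_mul_diagonal]
  simp

lemma aux_one {d : ℕ} {U : Matrix (Fin d) (Fin d) ℂ} (hU : U * star U = 1) :
    U * diagonal (fun _ => ((1 : ℝ) : ℂ)) * star U = 1 := by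
  simp [hU]

lemma aux_uu {d : ℕ} {A : Matrix (Fin d) (Fin d) ℂ} (hA : A.IsHermitian) :
    star (hA.eigenvectorUnitary : Matrix (Fin d) (Fin d) ℂ) * hA.eigenvectorUnitary = 1 ∧
    (hA.eigenvectorUnitary : Matrix (Fin d) (Fin d) ℂ) *
      star (hA.eigenvectorUnitary : Matrix (Fin d) (Fin d) ℂ) = 1 :=
  ⟨Unitary.coe_star_mul_self _, Unitary.coe_mul_star_self _⟩

/-- trace of psd times spectral nonneg function is nonneg -/
lemma aux_tr_nonneg {d : ℕ} {A : Matrix (Fin d) (Fin d) ℂ} (hA : A.PosSemidef)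
    (V : Matrix (Fin d) (Fin d) ℂ) (b : Fin d → ℝ) (hb : ∀ i, 0 ≤ b i) :
    0 ≤ (A * (V * diagonal (fun i => (b i : ℂ)) * star V)).trace.re := by
  rw [aux_spec hA.1, aux_tr]
  exact Finset.sum_nonneg fun i _ => Finset.sum_nonneg fun j _ =>
    mul_nonneg (Complex.normSq_nonneg _) (mul_nonneg (hA.eigenvalues_nonneg i) (hb j))

lemma aux_data {d : ℕ} {A B : Matrix (Fin d) (Fin d) ℂ} (hA : A.PosSemidef) (hB : B.PosSemidef)
    (k : ℝ) (hk : (k • B - A).PosSemidef) :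
    ∃ (p : Fin d → ℝ) (w : Fin d → Fin d → ℝ), (∀ i j, 0 ≤ w i j) ∧ (∀ i, 0 ≤ p i) ∧
      (∀ i j, hB.1.eigenvalues j = 0 → w i j = 0 ∨ p i = 0) ∧
      qRelEnt A B = ∑ i, ∑ j, w i j * (p i * (Real.log (p i) - Real.log (hB.1.eigenvalues j))) ∧
      A.trace.re - B.trace.re = ∑ i, ∑ j, w i j * (p i - hB.1.eigenvalues j) ∧
      ((A - B) * (A - B)).trace.re = ∑ i, ∑ j, w i j * (p i - hB.1.eigenvalues j) ^ 2 := by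
  obtain ⟨hU1, hU2⟩ := aux_uu hA.1
  obtain ⟨hV1, hV2⟩ := aux_uu hB.1
  have eA := aux_spec hA.1
  have eB := aux_spec hB.1
  have lA : matLog A = (hA.1.eigenvectorUnitary : Matrix (Fin d) (Fin d) ℂ) *
      Matrix.diagonal (fun i => (Real.log (hA.1.eigenvalues i) : ℂ)) *
      (star (hA.1.eigenvectorUnitary : Matrix (Fin d) (Fin d) ℂ)) := by
    rw [matLog, dif_pos hA.1]
  have lB : matLog B = (hB.1.eigenvectorUnitary : Matrix (Fin d) (Fin d) ℂ) *
      Matrix.diagonal (fun i => (Real.log (hB.1.eigenvalues i) : ℂ)) *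
      (star (hB.1.eigenvectorUnitary : Matrix (Fin d) (Fin d) ℂ)) := by
    rw [matLog, dif_pos hB.1]
  have hp := hA.eigenvalues_nonneg
  have hq := hB.eigenvalues_nonneg
  generalize (hA.1.eigenvectorUnitary : Matrix (Fin d) (Fin d) ℂ) = U at *
  generalize (hB.1.eigenvectorUnitary : Matrix (Fin d) (Fin d) ℂ) = V at *
  generalize hA.1.eigenvalues = p at *
  generalize hB.1.eigenvalues = q at *
  have oU := aux_one hU2
  have oV := aux_one hV2
  have AA : A * A = U * diagonal (fun i => ((p i * p i : ℝ) : ℂ)) * star U := by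
    conv_lhs => rw [eA, aux_mul hU1]
  have BB : B * B = V * diagonal (fun i => ((q i * q i : ℝ) : ℂ)) * star V := by
    conv_lhs => rw [eB, aux_mul hV1]
  have AL : A * matLog A = U * diagonal (fun i => ((p i * Real.log (p i) : ℝ) : ℂ)) * star U := by
    conv_lhs => rw [lA, eA, aux_mul hU1]
  have tA : A.trace.re = ∑ i, ∑ j, Complex.normSq ((star U * V) i j) * (p i * 1) := by
    rw [← aux_tr, oV, ← eA, Matrix.mul_one]
  have tB : B.trace.re = ∑ i, ∑ j, Complex.normSq ((star U * V) i j) * (1 * q j) := by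
    rw [← aux_tr U V (fun _ => 1), oU, ← eB, Matrix.one_mul]
  have tAA : (A * A).trace.re = ∑ i, ∑ j, Complex.normSq ((star U * V) i j) * ((p i * p i) * 1) := by
    rw [← aux_tr, oV, ← AA, Matrix.mul_one]
  have tBB : (B * B).trace.re = ∑ i, ∑ j, Complex.normSq ((star U * V) i j) * (1 * (q j * q j)) := by
    rw [← aux_tr U V (fun _ => 1), oU, ← BB, Matrix.one_mul]
  have tAB : (A * B).trace.re = ∑ i, ∑ j, Complex.normSq ((star U * V) i j) * (p i * q j) := by
    rw [← aux_tr, ← eA, ← eB]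
  have tAL : (A * matLog A).trace.re =
      ∑ i, ∑ j, Complex.normSq ((star U * V) i j) * ((p i * Real.log (p i)) * 1) := by
    rw [← aux_tr, oV, ← AL, Matrix.mul_one]
  have tALB : (A * matLog B).trace.re =
      ∑ i, ∑ j, Complex.normSq ((star U * V) i j) * (p i * Real.log (q j)) := by
    rw [← aux_tr, ← eA, ← lB]
  refine ⟨p, fun i j => Complex.normSq ((star U * V) i j), fun i j => Complex.normSq_nonneg _, hp,
    ?_, ?_, ?_, ?_⟩
  · set b : Fin d → ℝ := fun j => if q j = 0 then 1 else 0 with hb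
    have hb0 : ∀ j, 0 ≤ b j := fun j => by simp only [hb]; split_ifs <;> norm_num
    have h1 := aux_tr_nonneg hk V b hb0
    have h2 : (B * (V * diagonal (fun i => (b i : ℂ)) * star V)) = 0 := by
      conv_lhs => rw [eB, aux_mul hV1]
      have : (fun i => ((q i * b i : ℝ) : ℂ)) = fun _ => 0 := by
        funext i
        simp only [hb]; split_ifs with h <;> simp [h]
      rw [this]; simp
    have h3 : (A * (V * diagonal (fun i => (b i : ℂ)) * star V)).trace.re
        = ∑ i, ∑ j, Complex.normSq ((star U * V) i j) * (p i * b j) := by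
      rw [← aux_tr, ← eA]
    rw [Matrix.sub_mul, Matrix.smul_mul, h2, smul_zero, zero_sub, Matrix.trace_neg, Complex.neg_re,
      h3] at h1
    have hnn : ∀ i j, 0 ≤ Complex.normSq ((star U * V) i j) * (p i * b j) := fun i j =>
      mul_nonneg (Complex.normSq_nonneg _) (mul_nonneg (hp i) (hb0 j))
    have h4 : ∑ i, ∑ j, Complex.normSq ((star U * V) i j) * (p i * b j) = 0 :=
      le_antisymm (by linarith) (Finset.sum_nonneg fun i _ => Finset.sum_nonneg fun j _ => hnn i j)
    intro i j hj
    rw [Finset.sum_eq_zero_iff_of_nonneg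
      (fun i _ => Finset.sum_nonneg fun j _ => hnn i j)] at h4
    have h5 := h4 i (Finset.mem_univ _)
    rw [Finset.sum_eq_zero_iff_of_nonneg (fun j _ => hnn i j)] at h5
    have h6 := h5 j (Finset.mem_univ _)
    simpa [hb, hj] using h6
  · rw [qRelEnt, Matrix.mul_sub, Matrix.trace_sub, Complex.sub_re, tAL, tALB]
    simp only [← Finset.sum_sub_distrib]
    refine Finset.sum_congr rfl fun i _ => Finset.sum_congr rfl fun j _ => ?_
    ring
  · rw [tA, tB]
    simp only [← Finset.sum_sub_distrib]
    refine Finset.sum_congr rfl fun i _ => Finset.sum_congr rfl fun j _ => ?_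
    ring
  · have : (A - B) * (A - B) = A * A - A * B - (B * A - B * B) := by noncomm_ring
    rw [this]
    simp only [Matrix.trace_sub, Complex.sub_re]
    rw [Matrix.trace_mul_comm B A, tAA, tAB, tBB]
    simp only [← Finset.sum_sub_distrib]
    refine Finset.sum_congr rfl fun i _ => Finset.sum_congr rfl fun j _ => ?_
    ring

lemma aux_klein {d : ℕ} {A B : Matrix (Fin d) (Fin d) ℂ} (hA : A.PosSemidef) (hB : B.PosSemidef)
    (k : ℝ) (hk : (k • B - A).PosSemidef) (ht : A.trace = B.trace) : 0 ≤ qRelEnt A B := by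
  obtain ⟨p, w, hw, hp, h0, hD, hT, -⟩ := aux_data hA hB k hk
  have hq := hB.eigenvalues_nonneg
  rw [ht, sub_self] at hT
  rw [hD, hT]
  refine Finset.sum_le_sum fun i _ => Finset.sum_le_sum fun j _ => ?_
  rcases (hq j).eq_or_lt with h | h
  · rcases h0 i j h.symm with h1 | h1
    · simp [h1]
    · simp [h1, ← h]
  · refine mul_le_mul_of_nonneg_left ?_ (hw i j)
    rcases (hp i).eq_or_lt with h1 | h1
    · rw [← h1]; simp; exact h.le
    · have := Real.log_le_sub_one_of_pos (div_pos h h1)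
      rw [Real.log_div h.ne' h1.ne'] at this
      have h2 := mul_le_mul_of_nonneg_left this h1.le
      have h3 : p i * (hB.1.eigenvalues j / p i - 1) = hB.1.eigenvalues j - p i := by
        field_simp
      rw [h3] at h2
      linarith

lemma aux_chi {d : ℕ} {B : Matrix (Fin d) (Fin d) ℂ} (hB : B.PosSemidef) :
    ∃ C : ℝ, ∀ A : Matrix (Fin d) (Fin d) ℂ, A.PosSemidef → A.trace = B.trace →
      ∀ k : ℝ, (k • B - A).PosSemidef → qRelEnt A B ≤ C * ((A - B) * (A - B)).trace.re := by
  have hq := hB.eigenvalues_nonneg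
  refine ⟨∑ j, (hB.1.eigenvalues j)⁻¹, fun A hA ht k hk => ?_⟩
  obtain ⟨p, w, hw, hp, h0, hD, hT, hS⟩ := aux_data hA hB k hk
  have hC : ∀ j, (hB.1.eigenvalues j)⁻¹ ≤ ∑ j, (hB.1.eigenvalues j)⁻¹ := fun j =>
    Finset.single_le_sum (f := fun j => (hB.1.eigenvalues j)⁻¹)
      (fun j _ => inv_nonneg.2 (hq j)) (Finset.mem_univ j)
  generalize ∑ j, (hB.1.eigenvalues j)⁻¹ = C at *
  rw [ht, sub_self] at hT
  rw [hD, hS, ← zero_add (C * _), hT, Finset.mul_sum, ← Finset.sum_add_distrib]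
  refine Finset.sum_le_sum fun i _ => ?_
  rw [Finset.mul_sum, ← Finset.sum_add_distrib]
  refine Finset.sum_le_sum fun j _ => ?_
  rcases (hq j).eq_or_lt with h | h
  · rcases h0 i j h.symm with h1 | h1
    · simp [h1]
    · simp [h1, ← h]
  · have hCj := hC j
    generalize hB.1.eigenvalues j = q at *
    have key : p i * (Real.log (p i) - Real.log q) ≤ (p i - q) + C * (p i - q) ^ 2 := by
      have e : (p i - q) + q⁻¹ * (p i - q) ^ 2 = p i * (p i / q - 1) := by
        field_simp; ring
      have h5 : q⁻¹ * (p i - q) ^ 2 ≤ C * (p i - q) ^ 2 :=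
        mul_le_mul_of_nonneg_right hCj (sq_nonneg _)
      have h6 : p i * (Real.log (p i) - Real.log q) ≤ p i * (p i / q - 1) := by
        rcases (hp i).eq_or_lt with h1 | h1
        · simp [← h1]
        · refine mul_le_mul_of_nonneg_left ?_ h1.le
          rw [← Real.log_div h1.ne' h.ne']
          exact Real.log_le_sub_one_of_pos (div_pos h1 h)
      linarith
    have := mul_le_mul_of_nonneg_left key (hw i j)
    linarith

lemma aux_dom {d : ℕ} {A B : Matrix (Fin d) (Fin d) ℂ} (hA : A.PosSemidef) (hB : B.PosSemidef)
    (hs : SuppLE A B) : ∃ k : ℝ, 0 ≤ k ∧ (k • B - A).PosSemidef := by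
  have hX : ∃ X : Matrix (Fin d) (Fin d) ℂ, A = B * X := by
    have : ∀ j, ∃ x, B.mulVecLin x = A.mulVecLin (Pi.single j 1) := fun j =>
      hs ⟨Pi.single j 1, rfl⟩
    choose x hx using this
    refine ⟨Matrix.of fun i j => x j i, ?_⟩
    ext i j
    have := congrFun (hx j) i
    simp only [Matrix.mulVecLin_apply, Matrix.mulVec_single_one, Matrix.col_apply] at this
    rw [← this]
    rfl
  obtain ⟨X, hX⟩ := hX
  obtain ⟨hV1, hV2⟩ := aux_uu hB.1
  have eB := aux_spec hB.1
  have hq := hB.eigenvalues_nonneg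
  generalize (hB.1.eigenvectorUnitary : Matrix (Fin d) (Fin d) ℂ) = V at *
  generalize hB.1.eigenvalues = q at *
  set S := V * diagonal (fun i => ((√(q i) : ℝ) : ℂ)) * star V with hS
  set R := V * diagonal (fun i => (((√(q i))⁻¹ : ℝ) : ℂ)) * star V with hR
  have herm : ∀ a : Fin d → ℝ, (V * diagonal (fun i => (a i : ℂ)) * star V)ᴴ =
      V * diagonal (fun i => (a i : ℂ)) * star V := by
    intro a
    rw [Matrix.conjTranspose_mul, Matrix.conjTranspose_mul, Matrix.star_eq_conjTranspose,
      Matrix.conjTranspose_conjTranspose, Matrix.diagonal_conjTranspose, Matrix.mul_assoc]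
    have : star (fun i => (a i : ℂ)) = fun i => (a i : ℂ) := by
      ext i; simp
    rw [this]
  have hSh : Sᴴ = S := herm _
  have hRh : Rᴴ = R := herm _
  have SS : S * S = B := by
    rw [hS, aux_mul hV1, eB]
    congr 3
    funext i
    rw [Real.mul_self_sqrt (hq i)]
  have SRB : S * R * B = B := by
    rw [hS, hR, aux_mul hV1]
    conv_lhs => rw [eB]
    rw [aux_mul hV1]
    conv_rhs => rw [eB]
    congr 3
    funext i
    rcases (hq i).eq_or_lt with h | h
    · simp [← h]
    · rw [mul_inv_cancel₀ (Real.sqrt_pos.2 h).ne', one_mul]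
  have SRA : S * R * A = A := by
    rw [hX, ← Matrix.mul_assoc, SRB]
  have ARS : A * (R * S) = A := by
    have := congrArg Matrix.conjTranspose SRA
    rw [Matrix.conjTranspose_mul, Matrix.conjTranspose_mul, hSh, hRh, hA.1.eq] at this
    exact this
  have hT : (R * A * R).PosSemidef := by
    have := hA.mul_mul_conjTranspose_same R
    rwa [hRh] at this
  have hA2 : S * (R * A * R) * S = A := by
    calc S * (R * A * R) * S = S * R * (A * (R * S)) := by simp only [Matrix.mul_assoc]
      _ = A := by rw [ARS, SRA]
  generalize R * A * R = T at *
  have eT := aux_spec hT.1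
  obtain ⟨hW1, hW2⟩ := aux_uu hT.1
  have ht := hT.eigenvalues_nonneg
  have hle : ∀ i, hT.1.eigenvalues i ≤ ∑ i, hT.1.eigenvalues i := fun i =>
    Finset.single_le_sum (f := hT.1.eigenvalues) (fun j _ => ht j) (Finset.mem_univ i)
  refine ⟨∑ i, hT.1.eigenvalues i, Finset.sum_nonneg fun i _ => ht i, ?_⟩
  generalize (hT.1.eigenvectorUnitary : Matrix (Fin d) (Fin d) ℂ) = W at *
  generalize hT.1.eigenvalues = t at *
  generalize ∑ i, t i = k at *
  have h1 : (k • (1 : Matrix (Fin d) (Fin d) ℂ) - T).PosSemidef := by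
    have : k • (1 : Matrix (Fin d) (Fin d) ℂ) - T
        = W * diagonal (fun i => ((k - t i : ℝ) : ℂ)) * Wᴴ := by
      rw [eT, ← hW2]
      have : (diagonal (fun i => ((k - t i : ℝ) : ℂ)) : Matrix (Fin d) (Fin d) ℂ) =
        k • (1 : Matrix (Fin d) (Fin d) ℂ) - diagonal (fun i => (t i : ℂ)) := by
        ext i j
        by_cases h : i = j
        · subst h; simp
        · simp [h]
      rw [this, Matrix.mul_sub, Matrix.sub_mul, Matrix.mul_smul, Matrix.smul_mul, Matrix.mul_one,
        Matrix.star_eq_conjTranspose]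
    rw [this]
    refine Matrix.PosSemidef.mul_mul_conjTranspose_same ?_ W
    rw [Matrix.posSemidef_diagonal_iff]
    intro i
    exact_mod_cast sub_nonneg.2 (hle i)
  have h2 := h1.mul_mul_conjTranspose_same S
  rw [hSh, Matrix.mul_sub, Matrix.sub_mul, hA2, Matrix.mul_smul, Matrix.smul_mul, Matrix.mul_one,
    SS] at h2
  exact h2

/-- The linear part. -/
noncomputable def auxL {d d' : ℕ} (Φ : Matrix (Fin d) (Fin d) ℂ →ₗ[ℂ] Matrix (Fin d') (Fin d') ℂ)
    (Q : Matrix (Fin d) (Fin d) ℂ →ₗ[ℝ] ℝ) (φ X : Matrix (Fin d) (Fin d) ℂ) : ℝ :=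
  Q X + (X * matLog φ).trace.re - (Φ X * matLog (Φ φ)).trace.re

lemma auxL_smul {d d' : ℕ} (Φ : Matrix (Fin d) (Fin d) ℂ →ₗ[ℂ] Matrix (Fin d') (Fin d') ℂ)
    (Q : Matrix (Fin d) (Fin d) ℂ →ₗ[ℝ] ℝ) (φ X : Matrix (Fin d) (Fin d) ℂ) (t : ℝ) :
    auxL Φ Q φ (t • X) = t * auxL Φ Q φ X := by
  have : Φ (t • X) = t • Φ X := LinearMap.map_smul_of_tower Φ t X
  rw [auxL, auxL, this]
  simp
  ring

lemma aux_id {d d' : ℕ} (Φ : Matrix (Fin d) (Fin d) ℂ →ₗ[ℂ] Matrix (Fin d') (Fin d') ℂ)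
    (Q : Matrix (Fin d) (Fin d) ℂ →ₗ[ℝ] ℝ) (φ ρ : Matrix (Fin d) (Fin d) ℂ) :
    EPfun Φ Q ρ - EPfun Φ Q φ =
      auxL Φ Q φ (ρ - φ) + qRelEnt ρ φ - qRelEnt (Φ ρ) (Φ φ) := by
  simp only [EPfun, auxL, qRelEnt, vN, map_sub, Matrix.mul_sub, Matrix.sub_mul, Matrix.trace_sub,
    Complex.sub_re]
  ring

lemma aux_side {d d' : ℕ} (Φ : Matrix (Fin d) (Fin d) ℂ →ₗ[ℂ] Matrix (Fin d') (Fin d') ℂ)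
    (hΦ : IsPTP Φ) (Q : Matrix (Fin d) (Fin d) ℂ →ₗ[ℝ] ℝ) (φ σ : Matrix (Fin d) (Fin d) ℂ)
    (hφ : IsDensity φ) (hσ : IsDensity σ) (k : ℝ) (hk : (k • φ - σ).PosSemidef)
    (hmin : ∀ t : ℝ, 0 < t → t ≤ 1 → EPfun Φ Q φ ≤ EPfun Φ Q (φ + t • (σ - φ))) :
    0 ≤ auxL Φ Q φ (σ - φ) := by
  obtain ⟨C, hC⟩ := aux_chi hφ.1
  set N := ((σ - φ) * (σ - φ)).trace.re with hN
  set L := auxL Φ Q φ (σ - φ) with hL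
  have key : ∀ t : ℝ, 0 < t → t ≤ 1 → 0 ≤ L + t * (C * N) := by
    intro t ht0 ht1
    have hm := hmin t ht0 ht1
    have hid := aux_id Φ Q φ (φ + t • (σ - φ))
    rw [add_sub_cancel_left, auxL_smul] at hid
    have hps : (φ + t • (σ - φ)).PosSemidef := by
      have : φ + t • (σ - φ) = (1 - t) • φ + t • σ := by module
      rw [this]
      exact (hφ.1.smul (sub_nonneg.2 ht1)).add (hσ.1.smul ht0.le)
    have htr : (φ + t • (σ - φ)).trace = φ.trace := by
      simp [hφ.2, hσ.2]
    have hdom : ((1 - t + t * k) • φ - (φ + t • (σ - φ))).PosSemidef := by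
      have : (1 - t + t * k) • φ - (φ + t • (σ - φ)) = t • (k • φ - σ) := by module
      rw [this]
      exact hk.smul ht0.le
    have hD := hC _ hps htr _ hdom
    have hdom' := hΦ.1 _ hdom
    rw [map_sub, LinearMap.map_smul_of_tower] at hdom'
    have hK := aux_klein (hΦ.1 _ hps) (hΦ.1 _ hφ.1) _ hdom' (by rw [hΦ.2, hΦ.2, htr])
    have hsq : ((φ + t • (σ - φ) - φ) * (φ + t • (σ - φ) - φ)).trace.re = t * (t * N) := by
      rw [add_sub_cancel_left]
      simp [hN]
    rw [hsq] at hD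
    have : 0 ≤ t * (L + t * (C * N)) := by nlinarith
    exact nonneg_of_mul_nonneg_right this ht0
  by_contra! hneg
  rcases le_or_gt (C * N) 0 with h | h
  · have := key 1 one_pos le_rfl
    linarith
  · have hpos : 0 < min 1 (-L / (2 * (C * N))) := lt_min one_pos (by apply div_pos <;> linarith)
    have := key _ hpos (min_le_left _ _)
    have h2 : min 1 (-L / (2 * (C * N))) * (C * N) ≤ (-L / (2 * (C * N))) * (C * N) :=
      mul_le_mul_of_nonneg_right (min_le_right _ _) h.le
    have h3 : (-L / (2 * (C * N))) * (C * N) = -L / 2 := by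
      generalize C * N = y at *
      field_simp
    linarith

lemma aux_main {d d' : ℕ} (Φ : Matrix (Fin d) (Fin d) ℂ →ₗ[ℂ] Matrix (Fin d') (Fin d') ℂ)
    (hΦ : IsPTP Φ) (Q : Matrix (Fin d) (Fin d) ℂ →ₗ[ℝ] ℝ) (φ ρ : Matrix (Fin d) (Fin d) ℂ)
    (hφ : IsDensity φ) (hρ : IsDensity ρ) (hs : SuppLE ρ φ)
    (hmin : ∀ t : ℝ, IsDensity (φ + t • (ρ - φ)) →
      EPfun Φ Q φ ≤ EPfun Φ Q (φ + t • (ρ - φ))) :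
    EPfun Φ Q ρ - EPfun Φ Q φ = qRelEnt ρ φ - qRelEnt (Φ ρ) (Φ φ) := by
  obtain ⟨k, hk0, hk⟩ := aux_dom hρ.1 hφ.1 hs
  have htr : ∀ t : ℝ, (φ + t • (ρ - φ)).trace = 1 := fun t => by simp [hφ.2, hρ.2]
  have hpos : ∀ t : ℝ, 0 ≤ t → t ≤ 1 → (φ + t • (ρ - φ)).PosSemidef := by
    intro t ht0 ht1
    have : φ + t • (ρ - φ) = (1 - t) • φ + t • ρ := by module
    rw [this]
    exact (hφ.1.smul (sub_nonneg.2 ht1)).add (hρ.1.smul ht0)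
  have hneg : ∀ t : ℝ, 0 ≤ t → t * k ≤ 1 → (φ + (-t) • (ρ - φ)).PosSemidef := by
    intro t ht0 ht1
    have : φ + (-t) • (ρ - φ) = (1 - t * k + t) • φ + t • (k • φ - ρ) := by module
    rw [this]
    exact (hφ.1.smul (by linarith)).add (hk.smul ht0)
  have h1 : 0 ≤ auxL Φ Q φ (ρ - φ) :=
    aux_side Φ hΦ Q φ ρ hφ hρ k hk fun t h0 h1 => hmin t ⟨hpos t h0.le h1, htr t⟩
  set e : ℝ := (k + 1)⁻¹ with he
  have he0 : 0 < e := by positivity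
  have hek : e * k ≤ 1 := by
    rw [he, inv_mul_le_iff₀ (by positivity)]; linarith
  have h2 : 0 ≤ auxL Φ Q φ (φ + (-e) • (ρ - φ) - φ) := by
    refine aux_side Φ hΦ Q φ _ hφ ⟨hneg e he0.le hek, htr _⟩ (1 + e) ?_ ?_
    · have : (1 + e) • φ - (φ + (-e) • (ρ - φ)) = e • ρ := by module
      rw [this]; exact hρ.1.smul he0.le
    · intro t h0 h1
      have : φ + t • (φ + (-e) • (ρ - φ) - φ) = φ + (-(t * e)) • (ρ - φ) := by module
      rw [this]
      refine hmin _ ⟨hneg _ (by positivity) ?_, htr _⟩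
      have : t * (e * k) ≤ 1 * 1 := mul_le_mul h1 hek (by positivity) zero_le_one
      linarith
  rw [add_sub_cancel_left, auxL_smul] at h2
  have h3 : auxL Φ Q φ (ρ - φ) = 0 := le_antisymm (by nlinarith) h1
  rw [aux_id, h3]; ring

/-- Decomposition of global mismatch cost into nonnegative classical and quantum parts:
with `φ_P` an EP minimizer among states diagonal in an eigenbasis of `ρ` (the columns of the
unitary `V`) and `φ_D` a global EP minimizer,
`Σ(ρ) − Σ(φ_D) = [S(ρ‖φ_P) − S(Φρ‖Φφ_P)] + [S(φ_P‖φ_D) − S(Φφ_P‖Φφ_D)]`. -/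
theorem mismatch_cost_classical_quantum_decomposition {d d' : ℕ} (hd : 1 ≤ d) (hd' : 1 ≤ d')
    (Φ : Matrix (Fin d) (Fin d) ℂ →ₗ[ℂ] Matrix (Fin d') (Fin d') ℂ) (hΦ : IsPTP Φ)
    (Q : Matrix (Fin d) (Fin d) ℂ →ₗ[ℝ] ℝ)
    (ρ : Matrix (Fin d) (Fin d) ℂ) (hρ : IsDensity ρ)
    (V : Matrix (Fin d) (Fin d) ℂ) (hV : V ∈ Matrix.unitaryGroup (Fin d) ℂ)
    (c : Fin d → ℝ) (hdiag : ρ = V * Matrix.diagonal (fun i => (c i : ℂ)) * Vᴴ)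
    (DPv : Set (Matrix (Fin d) (Fin d) ℂ))
    (hDPv : DPv = {ω | IsDensity ω ∧ ∃ a : Fin d → ℂ, ω = V * Matrix.diagonal a * Vᴴ})
    (φP : Matrix (Fin d) (Fin d) ℂ) (hφP : φP ∈ DPv)
    (hminP : ∀ ω ∈ DPv, EPfun Φ Q φP ≤ EPfun Φ Q ω)
    (φD : Matrix (Fin d) (Fin d) ℂ) (hφD : IsDensity φD)
    (hminD : ∀ ω : Matrix (Fin d) (Fin d) ℂ, IsDensity ω → EPfun Φ Q φD ≤ EPfun Φ Q ω)
    (hsupp1 : SuppLE ρ φP) (hsupp2 : SuppLE φP φD) :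
    0 ≤ qRelEnt ρ φP - qRelEnt (Φ ρ) (Φ φP) ∧
    0 ≤ qRelEnt φP φD - qRelEnt (Φ φP) (Φ φD) ∧
    EPfun Φ Q ρ - EPfun Φ Q φD =
      (qRelEnt ρ φP - qRelEnt (Φ ρ) (Φ φP)) +
        (qRelEnt φP φD - qRelEnt (Φ φP) (Φ φD)) := by
  subst hDPv
  have hρP : ρ ∈ {ω | IsDensity ω ∧ ∃ a : Fin d → ℂ, ω = V * Matrix.diagonal a * Vᴴ} :=
    ⟨hρ, _, hdiag⟩
  obtain ⟨hφ, a, ha⟩ := hφP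
  have e1 := aux_main Φ hΦ Q φP ρ hφ hρ hsupp1 (by
    intro t ht
    refine hminP _ ⟨ht, a + t • ((fun i => (c i : ℂ)) - a), ?_⟩
    have : diagonal (a + t • ((fun i => (c i : ℂ)) - a)) =
        diagonal a + t • (diagonal (fun i => (c i : ℂ)) - diagonal a) := by
      ext i j
      by_cases h : i = j
      · subst h; simp
      · simp [h]
    rw [this, Matrix.mul_add, Matrix.add_mul, Matrix.mul_smul, Matrix.smul_mul, Matrix.mul_sub,
      Matrix.sub_mul, ← ha, ← hdiag])
  have e2 := aux_main Φ hΦ Q φD φP hφD hφ hsupp2 (fun t ht => hminD _ ht)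
  have m1 := hminP ρ hρP
  have m2 := hminD φP hφ
  refine ⟨by linarith, by linarith, by linarith⟩
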